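/- Let ε > 0, let Ψ be continuous on [0,1], and let Ψ_ε be its ε-convex hull. If m belongs to the closure Ē_{Ψ_ε} in [0,1] of the set of Ψ_ε-exposed points, then Ψ_ε(m) = Ψ(m). -/

import Mathlib

open Set

noncomputable section

/-- A function `f` is `ε`-convex on `[0,1]` if `m ↦ f m - ε·m²/2` is convex on `[0,1]`. -/
def EpsConvexOn (ε : ℝ) (f : ℝ → ℝ) : Prop :=
  ConvexOn ℝ (Set.Icc (0:ℝ) 1) (fun m => f m - ε * m ^ 2 / 2)

/-- The `ε`-convex hull of `f` on `[0,1]`: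
`f_ε(m) = sup {φ(m) : φ is ε-convex on [0,1] and φ ≤ f on [0,1]}`. -/
def epsHull (ε : ℝ) (f : ℝ → ℝ) (m : ℝ) : ℝ :=
  sSup {y : ℝ | ∃ φ : ℝ → ℝ, EpsConvexOn ε φ ∧ (∀ s ∈ Set.Icc (0:ℝ) 1, φ s ≤ f s) ∧ y = φ m}

/-- The `ε`-parabola (quadratic with second derivative `ε`) joining `(m1, y1)` and `(m2, y2)`. -/
def epsParabola (ε m1 m2 y1 y2 m : ℝ) : ℝ :=
  ((m2 - m) * y1 + (m - m1) * y2) / (m2 - m1) - ε / 2 * (m2 - m) * (m - m1)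

/-- `m ∈ [0,1]` is a `Ψ`-cluster point (with parameter `ε`). -/
def IsClusterPoint (ε : ℝ) (Ψ : ℝ → ℝ) (m : ℝ) : Prop :=
  m ∈ Set.Icc (0:ℝ) 1 ∧ ∃ m1 m2 : ℝ, 0 ≤ m1 ∧ m1 < m ∧ m < m2 ∧ m2 ≤ 1 ∧
    ∀ s ∈ Set.Icc (0:ℝ) 1,
      s * Ψ m1 + (1 - s) * Ψ m2 + ε / 2 * s * (1 - s) * (m2 - m1) ^ 2
        ≤ Ψ (s * m1 + (1 - s) * m2)

/-- The set `C_Ψ` of `Ψ`-cluster points. -/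
def clusterSet (ε : ℝ) (Ψ : ℝ → ℝ) : Set ℝ := {m | IsClusterPoint ε Ψ m}

/-- `m ∈ [0,1]` is a `Ψ`-exposed point (with parameter `ε`). -/
def IsExposedPoint (ε : ℝ) (Ψ : ℝ → ℝ) (m : ℝ) : Prop :=
  m ∈ Set.Icc (0:ℝ) 1 ∧ ∀ m1 m2 : ℝ, 0 ≤ m1 → m1 < m → m < m2 → m2 ≤ 1 →
    Ψ m < epsParabola ε m1 m2 (Ψ m1) (Ψ m2) m

/-- The set `E_Ψ` of `Ψ`-exposed points. -/
def exposedSet (ε : ℝ) (Ψ : ℝ → ℝ) : Set ℝ := {m | IsExposedPoint ε Ψ m}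

/-- The closure `Ē_Ψ` in `[0,1]` of the set of `Ψ`-exposed points. -/
def exposedClosure (ε : ℝ) (Ψ : ℝ → ℝ) : Set ℝ :=
  closure (exposedSet ε Ψ) ∩ Set.Icc (0:ℝ) 1

/-- `(m1, m2)` is a maximal open interval contained in the cluster set `C_Ψ`. -/
def IsMaxClusterInterval (ε : ℝ) (Ψ : ℝ → ℝ) (m1 m2 : ℝ) : Prop :=
  m1 < m2 ∧ Set.Ioo m1 m2 ⊆ clusterSet ε Ψ ∧
    ∀ a b : ℝ, Set.Ioo m1 m2 ⊆ Set.Ioo a b → Set.Ioo a b ⊆ clusterSet ε Ψ →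
      Set.Ioo a b = Set.Ioo m1 m2

/-- `W = V_Φ`: `W` is continuous on `[0,1]`, coincides with `V` on `Ē_Φ`, and is affine on
every maximal open interval contained in `C_Φ`. -/
def IsVInterp (ε : ℝ) (Φ V W : ℝ → ℝ) : Prop :=
  ContinuousOn W (Set.Icc (0:ℝ) 1) ∧
  (∀ m ∈ exposedClosure ε Φ, W m = V m) ∧
  ∀ m1 m2 : ℝ, IsMaxClusterInterval ε Φ m1 m2 →
    ∃ a b : ℝ, ∀ x ∈ Set.Ioo m1 m2, W x = a * x + b

theorem convexOn_affine (a b : ℝ) :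
    ConvexOn ℝ (Set.Icc (0:ℝ) 1) (fun x => a + b * x) := by
  refine ⟨convex_Icc 0 1, fun x _ y _ s t _ _ hst => le_of_eq ?_⟩
  simp only [smul_eq_mul]
  linear_combination (-a) * hst

/-- A continuous function on `[0,1]` lies above a downward cone with vertex just below its graph. -/
theorem exists_cone_le {g : ℝ → ℝ} (hg : ContinuousOn g (Set.Icc (0:ℝ) 1)) {p δ : ℝ}
    (hp : p ∈ Set.Icc (0:ℝ) 1) (hδ : 0 < δ) :
    ∃ N : ℝ, ∀ x ∈ Set.Icc (0:ℝ) 1, g p - δ - N * |x - p| ≤ g x := by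
  obtain ⟨r, hr, hclose⟩ := Metric.continuousOn_iff.1 hg p hp δ hδ
  obtain ⟨z, hz, hmin⟩ := isCompact_Icc.exists_isMinOn ⟨p, hp⟩ hg
  have hzp : g z ≤ g p := hmin hp
  refine ⟨(g p - g z) / r, fun x hx => ?_⟩
  have hN : 0 ≤ (g p - g z) / r := div_nonneg (by linarith) hr.le
  by_cases hxr : |x - p| < r
  · have h1 := hclose x hx (by rwa [Real.dist_eq])
    rw [Real.dist_eq] at h1
    have h2 := (abs_lt.1 h1).1
    have h3 := mul_nonneg hN (abs_nonneg (x - p))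
    linarith
  · have h1 : g z ≤ g x := hmin hx
    have h2 := mul_le_mul_of_nonneg_left (not_lt.1 hxr) hN
    rw [div_mul_cancel₀ _ hr.ne'] at h2
    linarith

theorem continuousOn_sub_parabola {ε : ℝ} {Ψ : ℝ → ℝ} (hΨ : ContinuousOn Ψ (Set.Icc (0:ℝ) 1)) :
    ContinuousOn (fun x => Ψ x - ε * x ^ 2 / 2) (Set.Icc (0:ℝ) 1) :=
  hΨ.sub (by fun_prop)

theorem le_epsHull {ε : ℝ} {Ψ φ : ℝ → ℝ}
    (hφ : ConvexOn ℝ (Set.Icc (0:ℝ) 1) φ)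
    (hle : ∀ s ∈ Set.Icc (0:ℝ) 1, φ s ≤ Ψ s - ε * s ^ 2 / 2)
    {m : ℝ} (hm : m ∈ Set.Icc (0:ℝ) 1) : φ m ≤ epsHull ε Ψ m - ε * m ^ 2 / 2 := by
  have : φ m + ε * m ^ 2 / 2 ≤ epsHull ε Ψ m := by
    refine le_csSup ⟨Ψ m, ?_⟩ ⟨fun x => φ x + ε * x ^ 2 / 2, ?_, ?_, rfl⟩
    · rintro y ⟨f, -, hf, rfl⟩
      exact hf m hm
    · simpa [EpsConvexOn] using hφ
    · intro s hs
      have := hle s hs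
      linarith
  linarith

theorem epsHull_candidates_nonempty {ε : ℝ} {Ψ : ℝ → ℝ}
    (hΨ : ContinuousOn Ψ (Set.Icc (0:ℝ) 1)) (m : ℝ) :
    {y : ℝ | ∃ φ : ℝ → ℝ, EpsConvexOn ε φ ∧
      (∀ s ∈ Set.Icc (0:ℝ) 1, φ s ≤ Ψ s) ∧ y = φ m}.Nonempty := by
  obtain ⟨z, hz, hmin⟩ := isCompact_Icc.exists_isMinOn
    (Set.nonempty_Icc.2 zero_le_one) (continuousOn_sub_parabola (ε := ε) hΨ)
  refine ⟨_, fun x => (Ψ z - ε * z ^ 2 / 2) + ε * x ^ 2 / 2, ?_, fun s hs => ?_, rfl⟩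
  · simpa [EpsConvexOn] using convexOn_const (Ψ z - ε * z ^ 2 / 2) (convex_Icc (0:ℝ) 1)
  · have : Ψ z - ε * z ^ 2 / 2 ≤ Ψ s - ε * s ^ 2 / 2 := hmin hs
    linarith

theorem epsHull_le {ε : ℝ} {Ψ : ℝ → ℝ} (hΨ : ContinuousOn Ψ (Set.Icc (0:ℝ) 1))
    {m : ℝ} (hm : m ∈ Set.Icc (0:ℝ) 1) : epsHull ε Ψ m ≤ Ψ m := by
  refine csSup_le (epsHull_candidates_nonempty hΨ m) ?_
  rintro y ⟨φ, -, hφ, rfl⟩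
  exact hφ m hm

theorem epsConvexOn_epsHull {ε : ℝ} {Ψ : ℝ → ℝ} (hΨ : ContinuousOn Ψ (Set.Icc (0:ℝ) 1)) :
    EpsConvexOn ε (epsHull ε Ψ) := by
  refine ⟨convex_Icc 0 1, fun x hx y hy s t hs ht hst => ?_⟩
  rw [sub_le_iff_le_add]
  refine csSup_le (epsHull_candidates_nonempty hΨ _) ?_
  rintro _ ⟨φ, hφ, hle, rfl⟩
  have hle' : ∀ u ∈ Set.Icc (0:ℝ) 1, φ u - ε * u ^ 2 / 2 ≤ Ψ u - ε * u ^ 2 / 2 :=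
    fun u hu => sub_le_sub_right (hle u hu) _
  have h1 := hφ.2 hx hy hs ht hst
  have h2 := mul_le_mul_of_nonneg_left (le_epsHull hφ hle' hx) hs
  have h3 := mul_le_mul_of_nonneg_left (le_epsHull hφ hle' hy) ht
  simp only [smul_eq_mul] at h1 ⊢
  linarith

theorem epsHull_zero {ε : ℝ} {Ψ : ℝ → ℝ} (hΨ : ContinuousOn Ψ (Set.Icc (0:ℝ) 1)) :
    epsHull ε Ψ 0 = Ψ 0 := by
  have h0 : (0:ℝ) ∈ Set.Icc (0:ℝ) 1 := by simp
  refine le_antisymm (epsHull_le hΨ h0) (le_of_forall_pos_le_add fun δ hδ => ?_)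
  obtain ⟨N, hN⟩ := exists_cone_le (continuousOn_sub_parabola (ε := ε) hΨ) h0 hδ
  have := le_epsHull (ε := ε) (Ψ := Ψ) (convexOn_affine (Ψ 0 - ε * 0 ^ 2 / 2 - δ) (-N)) (fun s hs => by
    have := hN s hs
    rw [sub_zero, abs_of_nonneg hs.1] at this
    linarith) h0
  linarith

theorem epsHull_one {ε : ℝ} {Ψ : ℝ → ℝ} (hΨ : ContinuousOn Ψ (Set.Icc (0:ℝ) 1)) :
    epsHull ε Ψ 1 = Ψ 1 := by
  have h1 : (1:ℝ) ∈ Set.Icc (0:ℝ) 1 := by simp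
  refine le_antisymm (epsHull_le hΨ h1) (le_of_forall_pos_le_add fun δ hδ => ?_)
  obtain ⟨N, hN⟩ := exists_cone_le (continuousOn_sub_parabola (ε := ε) hΨ) h1 hδ
  have := le_epsHull (ε := ε) (Ψ := Ψ) (convexOn_affine (Ψ 1 - ε * 1 ^ 2 / 2 - δ - N) N) (fun s hs => by
    have := hN s hs
    rw [abs_of_nonpos (by linarith [hs.2])] at this
    linarith) h1
  linarith

theorem continuousOn_epsHull_sub {ε : ℝ} {Ψ : ℝ → ℝ} (hΨ : ContinuousOn Ψ (Set.Icc (0:ℝ) 1)) :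
    ContinuousOn (fun x => epsHull ε Ψ x - ε * x ^ 2 / 2) (Set.Ioo (0:ℝ) 1) := by
  have h := (epsConvexOn_epsHull (ε := ε) hΨ).continuousOn_interior
  rwa [interior_Icc] at h

/-- The extension of a chord of a convex function lies below the function outside the chord. -/
theorem ConvexOn.chord_le_of_le_abs {h : ℝ → ℝ} {S : Set ℝ} (hh : ConvexOn ℝ S h)
    {m r A B x : ℝ} (hr : 0 < r) (h1 : h (m - r) = A - B * r) (h2 : h (m + r) = A + B * r)
    (hm1 : m - r ∈ S) (hm2 : m + r ∈ S) (hx : x ∈ S) (hxr : r ≤ |x - m|) :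
    A + B * (x - m) ≤ h x := by
  have hB : (h (m + r) - h (m - r)) / (m + r - (m - r)) = B := by
    rw [h1, h2, div_eq_iff (by linarith)]
    ring
  rcases le_abs.1 hxr with hxr | hxr
  · rcases hxr.eq_or_lt with he | hlt
    · rw [show x = m + r by linarith, h2]
      exact le_of_eq (by ring)
    · have hs := hh.slope_mono_adjacent hm1 hx (by linarith : m - r < m + r) (by linarith)
      rw [hB, le_div_iff₀ (by linarith), h2] at hs
      linarith
  · rcases hxr.eq_or_lt with he | hlt
    · rw [show x = m - r by linarith, h1]
      exact le_of_eq (by ring)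
    · have hs := hh.slope_mono_adjacent hx hm2 (by linarith : x < m - r) (by linarith)
      rw [hB, div_le_iff₀ (by linarith), h1] at hs
      linarith

theorem epsHull_eq_of_isExposedPoint {ε : ℝ} {Ψ : ℝ → ℝ}
    (hΨ : ContinuousOn Ψ (Set.Icc (0:ℝ) 1)) {m : ℝ} (hm : IsExposedPoint ε (epsHull ε Ψ) m) :
    epsHull ε Ψ m = Ψ m := by
  obtain ⟨hmI, hexp⟩ := hm
  rcases hmI.1.eq_or_lt with rfl | hm0
  · exact epsHull_zero hΨ
  rcases hmI.2.eq_or_lt with rfl | hm1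
  · exact epsHull_one hΨ
  refine le_antisymm (epsHull_le hΨ hmI) (not_lt.1 fun hlt => ?_)
  set h : ℝ → ℝ := fun x => epsHull ε Ψ x - ε * x ^ 2 / 2 with hh
  set g : ℝ → ℝ := fun x => Ψ x - ε * x ^ 2 / 2 with hg
  have hconv : ConvexOn ℝ (Set.Icc (0:ℝ) 1) h := epsConvexOn_epsHull hΨ
  have hhc : ContinuousAt h m :=
    (continuousOn_epsHull_sub hΨ).continuousAt (Ioo_mem_nhds hm0 hm1)
  have hgc : ContinuousAt g m :=
    (continuousOn_sub_parabola hΨ).continuousAt (Icc_mem_nhds hm0 hm1)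
  obtain ⟨K, hK1, hK2⟩ := exists_between (show h m < g m by simp only [hh, hg]; linarith)
  have hev := (hhc.eventually (gt_mem_nhds hK1)).and
    ((hgc.eventually (lt_mem_nhds hK2)).and (Ioo_mem_nhds hm0 hm1))
  obtain ⟨r, hr, hball⟩ := Metric.nhds_basis_closedBall.eventually_iff.1 hev
  simp only [Metric.mem_closedBall, Real.dist_eq] at hball
  obtain ⟨hh1, -, hI1⟩ := hball (x := m - r) (by rw [sub_sub_cancel_left, abs_neg, abs_of_pos hr])
  obtain ⟨hh2, -, hI2⟩ := hball (x := m + r) (by rw [add_sub_cancel_left, abs_of_pos hr])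
  set A := (h (m - r) + h (m + r)) / 2 with hA
  set B := (h (m + r) - h (m - r)) / (2 * r) with hB
  have hBr : B * r = (h (m + r) - h (m - r)) / 2 := by
    rw [hB]
    field_simp
  have e1 : h (m - r) = A - B * r := by rw [hBr, hA]; ring
  have e2 : h (m + r) = A + B * r := by rw [hBr, hA]; ring
  have hle : ∀ s ∈ Set.Icc (0:ℝ) 1, (h ⊔ fun x => (A - B * m) + B * x) s ≤ g s := by
    intro s hs
    have hhg : h s ≤ g s := sub_le_sub_right (epsHull_le hΨ hs) _
    refine sup_le hhg ?_
    rcases le_total |s - m| r with hsr | hsr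
    · have hgs := (hball hsr).2.1
      obtain ⟨ha, hb⟩ := abs_le.1 hsr
      rcases le_total 0 B with hB0 | hB0
      · have := mul_le_mul_of_nonneg_left hb hB0
        linarith
      · have := mul_le_mul_of_nonpos_left ha hB0
        linarith
    · have := hconv.chord_le_of_le_abs hr e1 e2 (Ioo_subset_Icc_self hI1)
        (Ioo_subset_Icc_self hI2) hs hsr
      linarith
  have hmax := le_epsHull (hconv.sup (convexOn_affine (A - B * m) B)) hle hmI
  have hAm : A ≤ h m := le_trans (sub_add_cancel A (B * m)).ge ((le_max_right _ _).trans hmax)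
  have hx := hexp (m - r) (m + r) hI1.1.le (by linarith) (by linarith) hI2.2.le
  have hpar : epsParabola ε (m - r) (m + r) (epsHull ε Ψ (m - r)) (epsHull ε Ψ (m + r)) m
      = A + ε * m ^ 2 / 2 := by
    simp only [epsParabola, hA, hh]
    have : m + r - (m - r) = 2 * r := by ring
    rw [this]
    field_simp
    ring
  rw [hpar] at hx
  simp only [hh] at hAm
  linarith

theorem stmt_9 (ε : ℝ) (hε : 0 < ε) (Ψ : ℝ → ℝ)
    (hΨc : ContinuousOn Ψ (Set.Icc (0:ℝ) 1))
    (m : ℝ) (hm : m ∈ exposedClosure ε (epsHull ε Ψ)) :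
    epsHull ε Ψ m = Ψ m := by
  obtain ⟨hcl, hmI⟩ := hm
  rcases hmI.1.eq_or_lt with rfl | hm0
  · exact epsHull_zero hΨc
  rcases hmI.2.eq_or_lt with rfl | hm1
  · exact epsHull_one hΨc
  have hhc := (continuousOn_epsHull_sub (ε := ε) hΨc).continuousAt (Ioo_mem_nhds hm0 hm1)
  have hgc := (continuousOn_sub_parabola (ε := ε) hΨc).continuousAt (Icc_mem_nhds hm0 hm1)
  have : (nhdsWithin m (exposedSet ε (epsHull ε Ψ))).NeBot := mem_closure_iff_nhdsWithin_neBot.1 hcl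
  have hev : (fun x => epsHull ε Ψ x - ε * x ^ 2 / 2)
      =ᶠ[nhdsWithin m (exposedSet ε (epsHull ε Ψ))] fun x => Ψ x - ε * x ^ 2 / 2 :=
    Filter.eventually_of_mem self_mem_nhdsWithin fun x hx =>
      congrArg (· - ε * x ^ 2 / 2) (epsHull_eq_of_isExposedPoint hΨc hx)
  exact sub_left_injective (tendsto_nhds_unique_of_eventuallyEq
    (hhc.mono_left nhdsWithin_le_nhds) (hgc.mono_left nhdsWithin_le_nhds) hev)
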